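/- Let P ⊂ ℝ^d be a lattice polytope of dimension d and c ∈ ℚ^d. If the function L^P_c : ℝ → ℝ defined by x ↦ #((xc + P) ∩ ℤ^d) is not almost constant, then there exists c' ∈ ℚ^d such that the Ehrhart quasi-polynomial L_{c'+P}(t) = #(t(c'+P) ∩ ℤ^d) does not satisfy the GCD-property with respect to the period den(c'). -/

import Mathlib

open Pointwise MeasureTheory
open scoped RealInnerProductSpace

noncomputable section

/-- Cast an integer vector to a real vector. -/
def castVec {d : ℕ} (x : Fin d → ℤ) : Fin d → ℝ := fun i => (x i : ℝ)

/-- Cast a rational vector to a real vector. -/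
def ratVec {d : ℕ} (c : Fin d → ℚ) : Fin d → ℝ := fun i => (c i : ℝ)

/-- `den(c)`: the lcm of the denominators of the coordinates of a rational vector. -/
def denv {d : ℕ} (c : Fin d → ℚ) : ℕ := Finset.univ.lcm fun i => (c i).den

/-- The number of lattice points in a subset of `ℝ^d`. -/
def latCount {d : ℕ} (S : Set (Fin d → ℝ)) : ℕ := {x : Fin d → ℤ | castVec x ∈ S}.ncard

/-- A lattice polytope: the convex hull of a nonempty finite set of integer points. -/
def IsLatticePolytope {d : ℕ} (P : Set (Fin d → ℝ)) : Prop :=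
  ∃ V : Finset (Fin d → ℤ), V.Nonempty ∧ P = convexHull ℝ (castVec '' (V : Set (Fin d → ℤ)))

/-- The zonotope spanned by a finite set of integer vectors. -/
def zonotopeF {d : ℕ} (U : Finset (Fin d → ℤ)) : Set (Fin d → ℝ) :=
  {x | ∃ lam : (Fin d → ℤ) → ℝ, (∀ u, lam u ∈ Set.Icc (0 : ℝ) 1) ∧
    x = ∑ u ∈ U, lam u • castVec u}

/-- The zonotope spanned by integer vectors `u 0, …, u (n-1)`. -/
def zonotopeZ {d n : ℕ} (u : Fin n → Fin d → ℤ) : Set (Fin d → ℝ) :=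
  {x | ∃ lam : Fin n → ℝ, (∀ i, lam i ∈ Set.Icc (0 : ℝ) 1) ∧ x = ∑ i, lam i • castVec (u i)}

/-- The zonotope spanned by real vectors `u 0, …, u (n-1)`. -/
def zonotopeR {d n : ℕ} (u : Fin n → Fin d → ℝ) : Set (Fin d → ℝ) :=
  {x | ∃ lam : Fin n → ℝ, (∀ i, lam i ∈ Set.Icc (0 : ℝ) 1) ∧ x = ∑ i, lam i • u i}

/-- A zonotope: a translate of the Minkowski sum of finitely many segments `[0, uᵢ]`. -/
def IsZonotope {d : ℕ} (P : Set (Fin d → ℝ)) : Prop :=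
  ∃ (n : ℕ) (u : Fin n → Fin d → ℝ) (v : Fin d → ℝ), P = v +ᵥ zonotopeR u

/-- A set is centrally symmetric if it is a translate of its negation. -/
def CentrallySymmetric {d : ℕ} (P : Set (Fin d → ℝ)) : Prop :=
  ∃ v : Fin d → ℝ, P = v +ᵥ (-P)

/-- `f` is a family of constituents of `L` with respect to the period `ρ`. -/
def IsConstituents (L : ℕ → ℚ) (ρ : ℕ) (f : ℕ → Polynomial ℚ) : Prop :=
  ∀ t : ℕ, 0 < t → L t = (f (t % ρ)).eval (t : ℚ)

/-- `ρ` is a period of the quasi-polynomial `L`. -/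
def IsPeriodOf (ρ : ℕ) (L : ℕ → ℚ) : Prop := 0 < ρ ∧ ∃ f, IsConstituents L ρ f

/-- `ρ₀` is the minimal period of the quasi-polynomial `L`. -/
def IsMinimalPeriodOf (ρ₀ : ℕ) (L : ℕ → ℚ) : Prop :=
  IsPeriodOf ρ₀ L ∧ ∀ ρ : ℕ, IsPeriodOf ρ L → ρ₀ ≤ ρ

/-- GCD-property with respect to the period `ρ`: constituents with equal
`gcd(ρ, ·)` coincide. -/
def GCDProperty (L : ℕ → ℚ) (ρ : ℕ) : Prop :=
  ∀ f : ℕ → Polynomial ℚ, IsConstituents L ρ f →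
    ∀ k ℓ : ℕ, Nat.gcd ρ k = Nat.gcd ρ ℓ → f (k % ρ) = f (ℓ % ρ)

/-- Symmetry with respect to the period `ρ`: `f_k = f_{ρ-k}` for `0 ≤ k ≤ ρ`. -/
def SymmetricQP (L : ℕ → ℚ) (ρ : ℕ) : Prop :=
  ∀ f : ℕ → Polynomial ℚ, IsConstituents L ρ f →
    ∀ k : ℕ, k ≤ ρ → f (k % ρ) = f ((ρ - k) % ρ)

/-- The Ehrhart counting function `t ↦ #(t(c + P) ∩ ℤ^d)` of the translate `c + P`. -/
def ehr {d : ℕ} (P : Set (Fin d → ℝ)) (c : Fin d → ℚ) : ℕ → ℚ :=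
  fun t => (latCount ((t : ℝ) • (ratVec c +ᵥ P)) : ℚ)

/-- The dimension of a polytope: the dimension of the direction of its affine hull. -/
def polyDim {d : ℕ} (P : Set (Fin d → ℝ)) : ℕ := Module.finrank ℝ (affineSpan ℝ P).direction

/-- `r` is the relative volume of `P` (of dimension `m`): with respect to any lattice
point `v₀` of `P` and any `ℤ`-basis `b` of the lattice `aff₀(P) ∩ ℤ^d`, `r` is the
Lebesgue measure of `P` in the coordinates determined by `v₀` and `b`. -/
def IsRelVolOf {d : ℕ} (P : Set (Fin d → ℝ)) (m : ℕ) (r : ℝ) : Prop :=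
  ∀ (v₀ : Fin d → ℤ) (b : Fin m → Fin d → ℤ),
    castVec v₀ ∈ P → LinearIndependent ℤ b →
    (∀ x : Fin d → ℤ,
      castVec x ∈ (affineSpan ℝ P).direction ↔ x ∈ Submodule.span ℤ (Set.range b)) →
    r = (volume {lam : Fin m → ℝ | castVec v₀ + ∑ i, lam i • castVec (b i) ∈ P}).toReal

/-- The (real casts of the) elements of `W` are linearly independent over `ℝ`. -/
def LinIndepF {d : ℕ} (W : Finset (Fin d → ℤ)) : Prop :=
  LinearIndependent ℝ fun w : ↥W => castVec w.1

/-- Almost locally constant: locally constant outside a discrete point set. -/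
def AlmostLocallyConstant (f : ℝ → ℝ) : Prop :=
  ∃ D : Set ℝ, DiscreteTopology D ∧ IsLocallyConstant fun x : ↥(Dᶜ) => f ↑x

/-- Almost constant: constant outside a discrete point set. -/
def AlmostConstant (f : ℝ → ℝ) : Prop :=
  ∃ D : Set ℝ, DiscreteTopology D ∧ ∃ r : ℝ, ∀ x ∉ D, f x = r

/-- The face of `P` in the outer normal direction `v`. -/
def normalFace {d : ℕ} (P : Set (EuclideanSpace ℝ (Fin d)))
    (v : EuclideanSpace ℝ (Fin d)) : Set (EuclideanSpace ℝ (Fin d)) :=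
  {x | x ∈ P ∧ ∀ y ∈ P, ⟪y, v⟫ ≤ ⟪x, v⟫}

/-- `F` is a facet of the `d`-polytope `P`: an exposed face of dimension `d - 1`. -/
def IsFacetOf {d : ℕ} (F P : Set (EuclideanSpace ℝ (Fin d))) : Prop :=
  (∃ v : EuclideanSpace ℝ (Fin d), v ≠ 0 ∧ F = normalFace P v) ∧
  Module.finrank ℝ (affineSpan ℝ F).direction = d - 1

open Filter Topology

lemma sum_eq_zero_of_sum_indicator_Icc_eq_zero {ι : Type*} (s : Finset ι) (a : ι → ℤ)
    (l r : ι → ℝ) (hlr : ∀ i ∈ s, l i ≤ r i)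
    (h : ∀ x, ∑ i ∈ s, (if x ∈ Set.Icc (l i) (r i) then a i else 0) = 0) :
    ∑ i ∈ s, a i = 0 := by
  classical
  have key : ∀ x, ∑ i ∈ s with r i = x, a i = 0 := by
    intro x
    have hev : ∀ᶠ y in 𝓝[>] x, ∀ i ∈ s,
        ((if x ∈ Set.Icc (l i) (r i) then a i else 0) -
          (if y ∈ Set.Icc (l i) (r i) then a i else 0)) = if r i = x then a i else 0 := by
      rw [Finset.eventually_all]
      intro i hi
      have hgt : ∀ᶠ y in 𝓝[>] x, x < y := eventually_mem_nhdsWithin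
      have hlt : ∀ z, x < z → ∀ᶠ y in 𝓝[>] x, y < z := fun z hz =>
        mem_nhdsWithin_of_mem_nhds (Iio_mem_nhds hz)
      have hi' := hlr i hi
      rcases lt_trichotomy (r i) x with hr | hr | hr
      · filter_upwards [hgt] with y hy
        rw [if_neg, if_neg, if_neg hr.ne, sub_zero]
        · rintro ⟨_, h2⟩; linarith
        · rintro ⟨_, h2⟩; linarith
      · filter_upwards [hgt] with y hy
        rw [if_pos, if_neg, if_pos hr, sub_zero]
        · rintro ⟨_, h2⟩; linarith
        · exact ⟨by linarith, hr.ge⟩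
      · rcases le_or_gt (l i) x with hl | hl
        · filter_upwards [hgt, hlt _ hr] with y hy hy'
          rw [if_pos, if_pos, if_neg hr.ne', sub_self]
          · exact ⟨by linarith, hy'.le⟩
          · exact ⟨hl, hr.le⟩
        · filter_upwards [hgt, hlt _ hl] with y hy hy'
          rw [if_neg, if_neg, if_neg hr.ne', sub_self]
          · rintro ⟨h2, _⟩; linarith
          · rintro ⟨h2, _⟩; linarith
    obtain ⟨y, hy⟩ := hev.exists
    rw [Finset.sum_filter, ← Finset.sum_congr rfl hy, Finset.sum_sub_distrib, h, h, sub_self]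
  rw [← Finset.sum_fiberwise_of_maps_to (t := s.image r) (g := r)
    fun i hi => Finset.mem_image_of_mem r hi]
  exact Finset.sum_eq_zero fun x _ => key x

open Classical in
/-- The Euler characteristic is well defined on the group generated by the indicator functions
of compact convex sets. -/
theorem sum_nonempty_eq_zero_of_sum_indicator_eq_zero (n : ℕ) {ι : Type*} (s : Finset ι)
    (a : ι → ℤ) (K : ι → Set (Fin n → ℝ)) (hconv : ∀ i, Convex ℝ (K i))
    (hcomp : ∀ i, IsCompact (K i)) (h : ∀ x, ∑ i ∈ s, (if x ∈ K i then a i else 0) = 0) :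
    ∑ i ∈ s, (if (K i).Nonempty then a i else 0) = 0 := by
  induction n with
  | zero =>
    refine (Finset.sum_congr rfl fun i _ => ?_).trans (h 0)
    congr 1
    rw [eq_iff_iff]
    exact ⟨fun ⟨y, hy⟩ => Subsingleton.elim y 0 ▸ hy, fun hy => ⟨_, hy⟩⟩
  | succ n ih =>
    let slice : ℝ → ι → Set (Fin n → ℝ) := fun x i => {y | (Fin.cons x y : Fin (n + 1) → ℝ) ∈ K i}
    have hslice : ∀ x, ∑ i ∈ s, (if (slice x i).Nonempty then a i else 0) = 0 := by
      intro x
      refine ih (slice x) (fun i => ?_) (fun i => ?_) fun y => h (Fin.cons x y)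
      · intro y hy z hz p q hp hq hpq
        have := hconv i hy hz hp hq hpq
        have hxx : p * x + q * x = x := by rw [← add_mul, hpq, one_mul]
        have heq : p • (Fin.cons x y : Fin (n + 1) → ℝ) + q • (Fin.cons x z : Fin (n + 1) → ℝ) =
            Fin.cons x (p • y + q • z) := by
          ext j
          refine Fin.cases ?_ (fun j => ?_) j <;> simp [hxx]
        rwa [heq] at this
      · have heq : slice x i = Fin.tail '' (K i ∩ {y | y 0 = x}) := by
          ext y
          constructor
          · exact fun hy => ⟨Fin.cons x y, ⟨hy, by simp⟩, by simp⟩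
          · rintro ⟨z, ⟨hz, rfl⟩, rfl⟩
            simpa [slice] using hz
        rw [heq]
        exact ((hcomp i).inter_right (isClosed_eq (continuous_apply 0) continuous_const)).image
          (by unfold Fin.tail; fun_prop)
    have hproj : ∀ i, (K i).Nonempty → ∃ l r : ℝ, l ≤ r ∧
        ∀ x, (slice x i).Nonempty ↔ x ∈ Set.Icc l r := by
      intro i hi
      have himg : ∀ x, (slice x i).Nonempty ↔ x ∈ (fun y : Fin (n + 1) → ℝ => y 0) '' K i := by
        intro x
        constructor
        · rintro ⟨y, hy⟩
          exact ⟨_, hy, by simp⟩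
        · rintro ⟨y, hy, rfl⟩
          exact ⟨Fin.tail y, by simpa [slice] using hy⟩
      have hne := hi.image fun y : Fin (n + 1) → ℝ => y 0
      have hc : IsCompact ((fun y : Fin (n + 1) → ℝ => y 0) '' K i) :=
        (hcomp i).image (continuous_apply 0)
      have hcv : Convex ℝ ((fun y : Fin (n + 1) → ℝ => y 0) '' K i) :=
        (hconv i).linear_image (LinearMap.proj 0 : (Fin (n + 1) → ℝ) →ₗ[ℝ] ℝ)
      have hIcc := eq_Icc_of_connected_compact ⟨hne, hcv.isPreconnected⟩ hc
      refine ⟨_, _, ?_, fun x => by rw [himg, hIcc]⟩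
      rw [hIcc] at hne
      exact Set.nonempty_Icc.1 hne
    choose! l r hlr hmem using hproj
    rw [← Finset.sum_filter]
    refine sum_eq_zero_of_sum_indicator_Icc_eq_zero _ a l r
      (fun i hi => hlr i (Finset.mem_filter.1 hi).2) fun x => ?_
    rw [Finset.sum_filter]
    refine (Finset.sum_congr rfl fun i _ => ?_).trans (hslice x)
    by_cases hi : (K i).Nonempty
    · simp only [hi, if_true, hmem i hi x]
    · have : ¬ (slice x i).Nonempty := fun ⟨y, hy⟩ => hi ⟨_, hy⟩
      simp [hi, this]

lemma mem_smul_convexHull_range_iff {E : Type*} [AddCommGroup E] [Module ℝ E] {k : ℕ}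
    (hk : 0 < k) (w : Fin k → E) {t : ℝ} (ht : 0 ≤ t) (x : E) :
    x ∈ t • convexHull ℝ (Set.range w) ↔
      ∃ μ : Fin k → ℝ, (∀ i, 0 ≤ μ i) ∧ ∑ i, μ i = t ∧ ∑ i, μ i • w i = x := by
  have : Nonempty (Fin k) := ⟨⟨0, hk⟩⟩
  have hhull : ∀ y, y ∈ convexHull ℝ (Set.range w) ↔
      ∃ μ : Fin k → ℝ, (∀ i, 0 ≤ μ i) ∧ ∑ i, μ i = 1 ∧ ∑ i, μ i • w i = y := by
    intro y
    constructor
    · intro hy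
      have himg : Set.range w ⊆ Fintype.linearCombination ℝ w '' stdSimplex ℝ (Fin k) := by
        rintro _ ⟨i, rfl⟩
        exact ⟨Pi.single i 1, single_mem_stdSimplex ℝ i, by simp⟩
      obtain ⟨μ, hμ, rfl⟩ := convexHull_min himg ((convex_stdSimplex ℝ (Fin k)).linear_image _) hy
      exact ⟨μ, hμ.1, hμ.2, rfl⟩
    · rintro ⟨μ, h0, h1, h2⟩
      exact mem_convexHull_of_exists_fintype μ w h0 h1 (fun i => ⟨i, rfl⟩) h2
  constructor
  · rintro ⟨y, hy, rfl⟩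
    obtain ⟨μ, h0, h1, rfl⟩ := (hhull y).1 hy
    refine ⟨t • μ, fun i => mul_nonneg ht (h0 i), ?_, ?_⟩
    · simp [← Finset.mul_sum, h1]
    · simp [Finset.smul_sum, mul_smul]
  · rintro ⟨μ, h0, h1, rfl⟩
    rcases ht.eq_or_lt with rfl | ht
    · have hμ : ∀ i, μ i = 0 := fun i =>
        (Finset.sum_eq_zero_iff_of_nonneg fun i _ => h0 i).1 h1 i (Finset.mem_univ i)
      exact ⟨w ⟨0, hk⟩, subset_convexHull ℝ _ ⟨_, rfl⟩, by simp [hμ]⟩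
    · refine ⟨∑ i, (t⁻¹ * μ i) • w i, (hhull _).2 ⟨fun i => t⁻¹ * μ i, fun i => ?_, ?_, rfl⟩, ?_⟩
      · exact mul_nonneg (inv_nonneg.2 ht.le) (h0 i)
      · rw [← Finset.mul_sum, h1, inv_mul_cancel₀ ht.ne']
      · simp [Finset.smul_sum, smul_smul, ht.ne']

open Classical in
/-- Inclusion–exclusion for the lattice translates of a cone along its generators. -/
lemma sum_neg_one_pow_card_mem_smul_convexHull {d k : ℕ} (hk : 0 < k)
    (w : Fin k → Fin d → ℝ) {t : ℕ} (hkt : k ≤ t) (x : Fin d → ℝ) :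
    ∑ S : Finset (Fin k), (if x - ∑ i ∈ S, w i ∈
      ((t - S.card : ℕ) : ℝ) • convexHull ℝ (Set.range w) then (-1 : ℤ) ^ S.card else 0) = 0 := by
  let K : Finset (Fin k) → Set (Fin k → ℝ) := fun S =>
    {μ | (∀ i, 0 ≤ μ i) ∧ ∑ i, μ i = t ∧ ∑ i, μ i • w i = x ∧ ∀ i ∈ S, 1 ≤ μ i}
  have hconv : ∀ S, Convex ℝ (K S) := by
    rintro S μ ⟨h1, h2, h3, h4⟩ ν ⟨g1, g2, g3, g4⟩ p q hp hq hpq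
    refine ⟨fun i => ?_, ?_, ?_, fun i hi => ?_⟩
    · exact add_nonneg (mul_nonneg hp (h1 i)) (mul_nonneg hq (g1 i))
    · simp only [Pi.add_apply, Pi.smul_apply, smul_eq_mul, Finset.sum_add_distrib,
        ← Finset.mul_sum, h2, g2, ← add_mul, hpq, one_mul]
    · simp only [Pi.add_apply, Pi.smul_apply, smul_eq_mul, add_smul, Finset.sum_add_distrib,
        mul_smul, ← Finset.smul_sum, h3, g3]
      rw [← add_smul, hpq, one_smul]
    · have := mul_le_mul_of_nonneg_left (h4 i hi) hp
      have := mul_le_mul_of_nonneg_left (g4 i hi) hq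
      simp only [Pi.add_apply, Pi.smul_apply, smul_eq_mul]
      linarith
  have hcomp : ∀ S, IsCompact (K S) := by
    intro S
    refine (isCompact_univ_pi fun _ : Fin k =>
      isCompact_Icc (a := (0 : ℝ)) (b := t)).of_isClosed_subset ?_ ?_
    · simp only [K, Set.ofPred_and, Set.ofPred_forall]
      refine IsClosed.inter (isClosed_iInter fun i => isClosed_le (by fun_prop) (by fun_prop))
        (IsClosed.inter (isClosed_eq (by fun_prop) (by fun_prop))
        (IsClosed.inter (isClosed_eq (by fun_prop) (by fun_prop))
        (isClosed_iInter fun i => isClosed_iInter fun _ =>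
          isClosed_le (by fun_prop) (by fun_prop))))
    · rintro μ ⟨h1, h2, -, -⟩ i -
      exact ⟨h1 i, h2 ▸ Finset.single_le_sum (fun j _ => h1 j) (Finset.mem_univ i)⟩
  have hne : ∀ S : Finset (Fin k), (K S).Nonempty ↔ x - ∑ i ∈ S, w i ∈
      ((t - S.card : ℕ) : ℝ) • convexHull ℝ (Set.range w) := by
    intro S
    have hS : S.card ≤ t := (card_finset_fin_le S).trans hkt
    have hind : ∑ i : Fin k, (if i ∈ S then (1 : ℝ) else 0) = S.card := by simp
    have hindw : ∑ i : Fin k, (if i ∈ S then (1 : ℝ) else 0) • w i = ∑ i ∈ S, w i := by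
      simp
    rw [mem_smul_convexHull_range_iff hk w (Nat.cast_nonneg _), Nat.cast_sub hS]
    constructor
    · rintro ⟨μ, h1, h2, h3, h4⟩
      refine ⟨fun i => μ i - if i ∈ S then 1 else 0, fun i => ?_, ?_, ?_⟩
      · dsimp only
        split_ifs with hi
        · linarith [h4 i hi]
        · linarith [h1 i]
      · rw [Finset.sum_sub_distrib, h2, hind]
      · simp only [sub_smul]
        rw [Finset.sum_sub_distrib, h3, hindw]
    · rintro ⟨μ, h1, h2, h3⟩
      refine ⟨fun i => μ i + if i ∈ S then 1 else 0, fun i => ?_, ?_, ?_, fun i hi => ?_⟩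
      · have := h1 i
        dsimp only
        split_ifs <;> linarith
      · rw [Finset.sum_add_distrib, h2, hind, sub_add_cancel]
      · simp only [add_smul]
        rw [Finset.sum_add_distrib, h3, hindw, sub_add_cancel]
      · simp only [hi, if_true]
        linarith [h1 i]
  simp only [← hne]
  refine sum_nonempty_eq_zero_of_sum_indicator_eq_zero k Finset.univ _ K hconv hcomp fun μ => ?_
  by_cases hμ : μ ∈ K ∅
  · obtain ⟨h1, h2, h3, -⟩ := hμ
    have hbig : ({i | 1 ≤ μ i} : Finset (Fin k)).Nonempty := by
      by_contra hcon
      have hlt : ∀ i, μ i < 1 := fun i => by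
        by_contra hi
        exact hcon ⟨i, by simpa using hi⟩
      have : ∑ i, μ i < ∑ _i : Fin k, (1 : ℝ) :=
        Finset.sum_lt_sum_of_nonempty ⟨⟨0, hk⟩, Finset.mem_univ _⟩ fun i _ => hlt i
      simp [h2] at this
      omega
    have hiff : ∀ S, μ ∈ K S ↔ S ∈ ({i | 1 ≤ μ i} : Finset (Fin k)).powerset := fun S => by
      simp [K, h1, h2, h3, Finset.subset_iff]
    simp only [hiff]
    rw [Finset.sum_ite_mem, Finset.univ_inter,
      Finset.sum_powerset_neg_one_pow_card_of_nonempty hbig]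
  · refine Finset.sum_eq_zero fun S _ => if_neg fun hS => hμ ?_
    exact ⟨hS.1, hS.2.1, hS.2.2.1, by simp⟩

lemma finite_setOf_castVec_mem {d : ℕ} {S : Set (Fin d → ℝ)} (hS : Bornology.IsBounded S) :
    {n : Fin d → ℤ | castVec n ∈ S}.Finite := by
  obtain ⟨R, hR⟩ := hS.exists_norm_le
  refine (Set.finite_Icc (fun _ => -⌈R⌉ : Fin d → ℤ) (fun _ => ⌈R⌉)).subset fun n hn => ?_
  have h : ∀ i, |(n i : ℝ)| ≤ ⌈R⌉ := fun i =>
    ((norm_le_pi_norm (castVec n) i).trans (hR _ hn)).trans (Int.le_ceil R)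
  have h' : ∀ i, |n i| ≤ ⌈R⌉ := fun i => by exact_mod_cast h i
  exact ⟨fun i => (abs_le.1 (h' i)).1, fun i => (abs_le.1 (h' i)).2⟩

lemma latCount_castVec_vadd {d : ℕ} (z : Fin d → ℤ) (S : Set (Fin d → ℝ)) :
    latCount (castVec z +ᵥ S) = latCount S := by
  unfold latCount
  rw [← Set.ncard_image_of_injective {n : Fin d → ℤ | castVec n ∈ S} (add_right_injective z)]
  congr 1
  ext n
  constructor
  · rintro ⟨y, hy, hyn⟩
    refine ⟨n - z, ?_, by simp⟩
    have : castVec (n - z) = y := by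
      ext i
      have := congrFun hyn i
      simp [castVec] at this ⊢
      linarith
    simpa [this] using hy
  · rintro ⟨m, hm, rfl⟩
    exact ⟨castVec m, hm, by ext i; simp [castVec]⟩

lemma exists_polynomial_of_fwdDiff_iter_eq_zero (a : ℕ → ℤ) (k : ℕ)
    (h : ∀ t, (fwdDiff 1)^[k] a t = 0) :
    ∃ p : Polynomial ℚ, ∀ t : ℕ, p.eval (t : ℚ) = a t := by
  have hz : ∀ j, k ≤ j → ∀ t, (fwdDiff 1)^[j] a t = 0 := by
    intro j hj
    induction j, hj using Nat.le_induction with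
    | base => exact h
    | succ j _ ih => intro t; simp [Function.iterate_succ_apply', fwdDiff, ih]
  refine ⟨∑ j ∈ Finset.range k,
    Polynomial.C (((fwdDiff 1)^[j] a 0 : ℤ) / (j.factorial : ℚ)) * descPochhammer ℚ j, fun t => ?_⟩
  have hN := shift_eq_sum_fwdDiff_iter (1 : ℕ) a t 0
  simp only [zero_add, smul_eq_mul, mul_one] at hN
  have hsum : ∑ j ∈ Finset.range (t + 1), t.choose j • (fwdDiff 1)^[j] a 0 =
      ∑ j ∈ Finset.range k, t.choose j • (fwdDiff 1)^[j] a 0 := by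
    rcases le_total (t + 1) k with hle | hle
    · refine Finset.sum_subset (Finset.range_mono hle) fun j _ hj => ?_
      rw [Nat.choose_eq_zero_of_lt (by simpa using hj), zero_smul]
    · refine (Finset.sum_subset (Finset.range_mono hle) fun j _ hj => ?_).symm
      rw [hz j (by simpa using hj), smul_zero]
  rw [hN, hsum, Polynomial.eval_finsetSum]
  push_cast
  refine Finset.sum_congr rfl fun j _ => ?_
  rw [Polynomial.eval_mul, Polynomial.eval_C, descPochhammer_eval_eq_descFactorial,
    Nat.descFactorial_eq_factorial_mul_choose]
  have : (j.factorial : ℚ) ≠ 0 := by positivity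
  push_cast
  simp only [nsmul_eq_mul, Int.cast_mul, Int.cast_natCast]
  field_simp

/-- Ehrhart's theorem for real translates of dilates of lattice polytopes. -/
theorem IsLatticePolytope.exists_polynomial_latCount {d : ℕ} {P : Set (Fin d → ℝ)}
    (hP : IsLatticePolytope P) (v : Fin d → ℝ) :
    ∃ p : Polynomial ℚ, ∀ t : ℕ, p.eval (t : ℚ) = latCount (v +ᵥ (t : ℝ) • P) := by
  classical
  obtain ⟨V, hV, rfl⟩ := hP
  let k := V.card
  have hk : 0 < k := hV.card_pos
  let u : Fin k → Fin d → ℤ := fun i => (V.equivFin.symm i).1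
  have hu : castVec '' (V : Set (Fin d → ℤ)) = Set.range fun i => castVec (u i) := by
    have : (V : Set (Fin d → ℤ)) = Set.range u := by
      change _ = Set.range (Subtype.val ∘ V.equivFin.symm)
      rw [Set.range_comp, V.equivFin.symm.surjective.range_eq, Set.image_univ]
      simp
    rw [this, ← Set.range_comp]
    rfl
  rw [hu]
  set P := convexHull ℝ (Set.range fun i => castVec (u i))
  have hPb : Bornology.IsBounded P :=
    (isBounded_convexHull).2 (Set.finite_range _).isBounded
  have hfin : ∀ (y : Fin d → ℝ) (t : ℝ), {n : Fin d → ℤ | castVec n ∈ y +ᵥ t • P}.Finite :=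
    fun y t => finite_setOf_castVec_mem ((hPb.smul₀ t).vadd y)
  have hrec : ∀ t, k ≤ t → ∑ S : Finset (Fin k),
      (-1 : ℤ) ^ S.card * (latCount (v +ᵥ ((t - S.card : ℕ) : ℝ) • P) : ℤ) = 0 := by
    intro t ht
    have hall : (⋃ S : Finset (Fin k), {n : Fin d → ℤ | castVec n ∈
        castVec (∑ i ∈ S, u i) +ᵥ (v +ᵥ ((t - S.card : ℕ) : ℝ) • P)}).Finite :=
      Set.finite_iUnion fun S => by simpa only [vadd_vadd] using hfin _ _
    have hcount : ∀ S : Finset (Fin k), (-1 : ℤ) ^ S.card *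
        (latCount (v +ᵥ ((t - S.card : ℕ) : ℝ) • P) : ℤ) = ∑ n ∈ hall.toFinset,
        if castVec n - v - ∑ i ∈ S, castVec (u i) ∈ ((t - S.card : ℕ) : ℝ) • P then
          (-1 : ℤ) ^ S.card else 0 := by
      intro S
      have hmem : ∀ n : Fin d → ℤ, castVec n - v - ∑ i ∈ S, castVec (u i) ∈
          ((t - S.card : ℕ) : ℝ) • P ↔ castVec n ∈
          castVec (∑ i ∈ S, u i) +ᵥ (v +ᵥ ((t - S.card : ℕ) : ℝ) • P) := by
        intro n
        have hs : castVec (∑ i ∈ S, u i) = ∑ i ∈ S, castVec (u i) := by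
          ext j
          simp [castVec]
        rw [Set.mem_vadd_set_iff_neg_vadd_mem, Set.mem_vadd_set_iff_neg_vadd_mem, hs]
        simp only [vadd_eq_add]
        rw [show castVec n - v - ∑ i ∈ S, castVec (u i) =
          -v + (-∑ i ∈ S, castVec (u i) + castVec n) by abel]
      rw [← latCount_castVec_vadd (∑ i ∈ S, u i), latCount, ← Finset.sum_filter,
        Finset.sum_const, nsmul_eq_mul, mul_comm]
      congr 1
      rw [Nat.cast_inj]
      refine Eq.trans (congrArg Set.ncard ?_) (Set.ncard_coe_finset _)
      ext n
      simp only [Finset.coe_filter, Set.Finite.mem_toFinset, Set.mem_ofPred_eq, hmem]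
      exact ⟨fun h => ⟨Set.mem_iUnion.2 ⟨S, h⟩, h⟩, And.right⟩
    rw [Finset.sum_congr rfl fun S _ => hcount S, Finset.sum_comm]
    exact Finset.sum_eq_zero fun n _ => sum_neg_one_pow_card_mem_smul_convexHull hk _ ht _
  obtain ⟨p, hp⟩ := exists_polynomial_of_fwdDiff_iter_eq_zero
    (fun t => (latCount (v +ᵥ (t : ℝ) • P) : ℤ)) k fun t => by
      rw [fwdDiff_iter_eq_sum_shift, ← hrec (t + k) (Nat.le_add_left k t),
        ← Finset.powerset_univ, Finset.sum_powerset_apply_card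
          (fun j => (-1 : ℤ) ^ j * (latCount (v +ᵥ ((t + k - j : ℕ) : ℝ) • P) : ℤ)),
        ← Finset.sum_range_reflect, Finset.card_univ, Fintype.card_fin]
      refine Finset.sum_congr rfl fun j hj => ?_
      have hj' : j ≤ k := Nat.lt_succ_iff.1 (Finset.mem_range.1 hj)
      simp only [Nat.add_sub_cancel, smul_eq_mul, mul_one, nsmul_eq_mul]
      rw [Nat.choose_symm hj', Nat.sub_sub_self hj', Nat.add_sub_assoc hj']
      ring
  exact ⟨p, fun t => by rw [hp t]; simp⟩

lemma eventually_mem_iff_nhdsGT {T : Set ℝ} (hT : T.OrdConnected) (x : ℝ) :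
    ∃ p : Prop, ∀ᶠ y in 𝓝[>] x, (y ∈ T ↔ p) := by
  by_cases hfreq : ∃ᶠ y in 𝓝[>] x, y ∈ T
  · refine ⟨True, ?_⟩
    obtain ⟨b, hbT, hxb⟩ :=
      (hfreq.and_eventually (eventually_mem_nhdsWithin (s := Set.Ioi x))).exists
    filter_upwards [Ioo_mem_nhdsGT hxb] with y hy
    obtain ⟨a, haT, ha⟩ := (hfreq.and_eventually (Ioo_mem_nhdsGT hy.1)).exists
    exact iff_true_intro (hT.out haT hbT ⟨ha.2.le, hy.2.le⟩)
  · refine ⟨False, ?_⟩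
    filter_upwards [not_frequently.1 hfreq] with y hy
    exact iff_false_intro hy

lemma eventually_mem_iff_nhdsLT {T : Set ℝ} (hT : T.OrdConnected) (x : ℝ) :
    ∃ p : Prop, ∀ᶠ y in 𝓝[<] x, (y ∈ T ↔ p) := by
  by_cases hfreq : ∃ᶠ y in 𝓝[<] x, y ∈ T
  · refine ⟨True, ?_⟩
    obtain ⟨b, hbT, hxb⟩ :=
      (hfreq.and_eventually (eventually_mem_nhdsWithin (s := Set.Iio x))).exists
    filter_upwards [Ioo_mem_nhdsLT hxb] with y hy
    obtain ⟨a, haT, ha⟩ := (hfreq.and_eventually (Ioo_mem_nhdsLT hy.2)).exists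
    exact iff_true_intro (hT.out hbT haT ⟨hy.1.le, ha.1.le⟩)
  · refine ⟨False, ?_⟩
    filter_upwards [not_frequently.1 hfreq] with y hy
    exact iff_false_intro hy

lemma latCount_smul_vadd_eventually_const {d : ℕ} {P : Set (Fin d → ℝ)}
    (hb : Bornology.IsBounded P) (hP : Convex ℝ P) (v : Fin d → ℝ) {x : ℝ} {l : Filter ℝ}
    (hlx : l ≤ 𝓝 x)
    (hl : ∀ T : Set ℝ, T.OrdConnected → ∃ p : Prop, ∀ᶠ y in l, (y ∈ T ↔ p)) :
    ∃ r : ℕ, ∀ᶠ y in l, latCount (y • v +ᵥ P) = r := by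
  let J : Set (Fin d → ℝ) := (fun y : ℝ => y • v) '' Set.Icc (x - 1) (x + 1) + P
  have hJ : Bornology.IsBounded J :=
    (isCompact_Icc.image (by fun_prop : Continuous fun y : ℝ => y • v)).isBounded.add hb
  have hF := finite_setOf_castVec_mem hJ
  have hconv : ∀ n : Fin d → ℤ, {y : ℝ | castVec n ∈ y • v +ᵥ P}.OrdConnected := by
    intro n
    refine Convex.ordConnected ?_
    intro y hy z hz p q hp hq hpq
    obtain ⟨a, ha, hya⟩ := hy
    obtain ⟨b, hb, hzb⟩ := hz
    refine ⟨p • a + q • b, hP ha hb hp hq hpq, ?_⟩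
    simp only [vadd_eq_add] at hya hzb ⊢
    calc (p • y + q • z) • v + (p • a + q • b) = p • (y • v + a) + q • (z • v + b) := by
          simp only [smul_eq_mul]; module
      _ = castVec n := by rw [hya, hzb, ← add_smul, hpq, one_smul]
  choose p hp using fun n => hl _ (hconv n)
  refine ⟨{n | castVec n ∈ J ∧ p n}.ncard, ?_⟩
  filter_upwards [(hF.eventually_all).2 fun n _ => hp n,
    hlx (Icc_mem_nhds (sub_one_lt x) (lt_add_one x))] with y hy hyI
  unfold latCount
  congr 1
  ext n
  have hsub : castVec n ∈ y • v +ᵥ P → castVec n ∈ J := by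
    rintro ⟨a, ha, han⟩
    exact ⟨y • v, ⟨y, hyI, rfl⟩, a, ha, han⟩
  exact ⟨fun h => ⟨hsub h, (hy n (hsub h)).1 h⟩, fun h => (hy n h.1).2 h.2⟩

lemma exists_ne_of_not_almostConstant {f : ℝ → ℝ}
    (hr : ∀ x, ∃ r, ∀ᶠ y in 𝓝[>] x, f y = r) (hl : ∀ x, ∃ r, ∀ᶠ y in 𝓝[<] x, f y = r)
    (hf : ¬ AlmostConstant f) :
    ∃ x y, (∀ᶠ z in 𝓝 x, f z = f x) ∧ (∀ᶠ z in 𝓝 y, f z = f y) ∧ f x ≠ f y := by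
  by_contra! hcon
  refine hf ⟨{x | ¬ ∀ᶠ z in 𝓝 x, f z = f x}, ?_, ?_⟩
  · rw [discreteTopology_subtype_iff]
    intro x _
    have hloc : ∀ s : Set ℝ, IsOpen s → (∃ r, ∀ᶠ y in 𝓝[s] x, f y = r) →
        ∀ᶠ y in 𝓝[s] x, ∀ᶠ z in 𝓝 y, f z = f y := by
      rintro s hs ⟨r, hr⟩
      filter_upwards [eventually_eventually_nhdsWithin.2 hr, hr,
        eventually_mem_nhdsWithin] with y hy hyr hys
      rw [hs.nhdsWithin_eq hys] at hy
      filter_upwards [hy] with z hz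
      rw [hz, hyr]
    rw [inf_principal_eq_bot, ← nhdsLT_sup_nhdsGT]
    refine mem_sup.2 ⟨?_, ?_⟩
    · filter_upwards [hloc _ isOpen_Iio (hl x)] with y hy using not_not.2 hy
    · filter_upwards [hloc _ isOpen_Ioi (hr x)] with y hy using not_not.2 hy
  · by_cases hne : ∃ x, ∀ᶠ z in 𝓝 x, f z = f x
    · obtain ⟨x, hx⟩ := hne
      exact ⟨f x, fun y hy => hcon y x (not_not.1 hy) hx⟩
    · exact ⟨0, fun y hy => (hne ⟨y, not_not.1 hy⟩).elim⟩

lemma denv_pos {d : ℕ} (c : Fin d → ℚ) : 0 < denv c :=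
  Nat.pos_of_ne_zero fun h => by
    obtain ⟨i, -, hi⟩ := Finset.lcm_eq_zero_iff.1 h
    exact (c i).den_nz hi

lemma exists_castVec_eq_smul_ratVec {d : ℕ} (c : Fin d → ℚ) {m : ℕ} (hm : denv c ∣ m) :
    ∃ z : Fin d → ℤ, castVec z = (m : ℝ) • ratVec c := by
  have h : ∀ i, (c i).den ∣ m := fun i => (Finset.dvd_lcm (Finset.mem_univ i)).trans hm
  choose q hq using h
  refine ⟨fun i => q i * (c i).num, ?_⟩
  ext i
  have : (m : ℚ) * c i = q i * (c i).num := by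
    rw [hq i, Nat.cast_mul, mul_right_comm, mul_comm ((c i).den : ℚ), Rat.mul_den_eq_num, mul_comm]
  simp only [castVec, ratVec, Pi.smul_apply, smul_eq_mul]
  exact_mod_cast this.symm

lemma denv_inv_smul_dvd {d : ℕ} (c : Fin d → ℚ) (N : ℕ) :
    denv ((N : ℚ)⁻¹ • c) ∣ N * denv c := by
  refine Finset.lcm_dvd fun i _ => ?_
  have h : ((N : ℚ)⁻¹ • c) i = Rat.divInt (c i).num ((N * (c i).den : ℕ) : ℤ) := by
    rw [Rat.divInt_eq_div, Pi.smul_apply, smul_eq_mul]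
    conv_lhs => rw [← Rat.num_div_den (c i)]
    push_cast
    rw [div_eq_mul_inv, div_eq_mul_inv, mul_inv]
    ring
  rw [h]
  exact (Int.natCast_dvd_natCast.1 (Rat.den_dvd _ _)).trans
    (mul_dvd_mul_left N (Finset.dvd_lcm (Finset.mem_univ i)))

lemma latCount_mod_denv_smul_vadd {d : ℕ} (c : Fin d → ℚ) (S : Set (Fin d → ℝ)) (k : ℕ) :
    latCount ((k : ℝ) • ratVec c +ᵥ S) = latCount (((k % denv c : ℕ) : ℝ) • ratVec c +ᵥ S) := by
  obtain ⟨z, hz⟩ := exists_castVec_eq_smul_ratVec c (Dvd.intro (k / denv c) rfl)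
  have hk : (k : ℝ) • ratVec c = castVec z + ((k % denv c : ℕ) : ℝ) • ratVec c := by
    rw [hz, ← add_smul, ← Nat.cast_add, Nat.div_add_mod]
  rw [hk, ← vadd_vadd, latCount_castVec_vadd]

/-- The GCD-property of `c + P` equates lattice point counts of translates of `P` itself. -/
lemma IsLatticePolytope.latCount_eq_of_gcdProperty {d : ℕ} {P : Set (Fin d → ℝ)}
    (hP : IsLatticePolytope P) {c : Fin d → ℚ} (h : GCDProperty (ehr P c) (denv c)) {k l : ℕ}
    (hkl : Nat.gcd (denv c) k = Nat.gcd (denv c) l) :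
    latCount ((k : ℝ) • ratVec c +ᵥ P) = latCount ((l : ℝ) • ratVec c +ᵥ P) := by
  choose f hf using fun k : ℕ => hP.exists_polynomial_latCount ((k : ℝ) • ratVec c)
  have hcons : IsConstituents (ehr P c) (denv c) f := by
    intro t _
    have hset : (t : ℝ) • (ratVec c +ᵥ P) = (t : ℝ) • ratVec c +ᵥ (t : ℝ) • P := by
      simp only [← Set.image_smul, ← Set.image_vadd, Set.image_image, vadd_eq_add, smul_add]
    rw [hf, ehr, hset, latCount_mod_denv_smul_vadd]
  have heq := congrArg (Polynomial.eval ((1 : ℕ) : ℚ)) (h f hcons k l hkl)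
  rw [hf, hf, Nat.cast_inj, Nat.cast_one, one_smul] at heq
  rw [latCount_mod_denv_smul_vadd c P k, latCount_mod_denv_smul_vadd c P l, heq]

lemma exists_coprime_div_pow_near {f : ℝ → ℝ} {M : ℕ} (hM : 2 ≤ M)
    (hper : ∀ (x : ℝ) (n : ℕ), f (x + n * M) = f x) {x : ℝ} (hx : ∀ᶠ z in 𝓝 x, f z = f x) :
    ∀ᶠ m : ℕ in atTop, ∃ k : ℕ, k.Coprime M ∧ f (k / (M : ℝ) ^ m) = f x := by
  have hM0 : (0 : ℝ) < M := by positivity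
  obtain ⟨n, hn⟩ := exists_nat_gt (-x / M)
  rw [div_lt_iff₀ hM0] at hn
  set y := x + n * M with hy
  have hy0 : 0 ≤ y := by linarith
  obtain ⟨ε, hε, hball⟩ := Metric.eventually_nhds_iff.1 hx
  have hlim : Tendsto (fun m : ℕ => (M : ℝ) ^ m) atTop atTop :=
    tendsto_pow_atTop_atTop_of_one_lt (by exact_mod_cast hM)
  filter_upwards [hlim.eventually_gt_atTop (M / ε)] with m hm
  have hpow : (0 : ℝ) < (M : ℝ) ^ m := by positivity
  set j := ⌊y * (M : ℝ) ^ m / M⌋₊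
  have hj1 : j * M ≤ y * (M : ℝ) ^ m := by
    rw [← le_div_iff₀ hM0]
    exact Nat.floor_le (by positivity)
  have hj2 : y * (M : ℝ) ^ m < (j + 1) * M := by
    rw [← div_lt_iff₀ hM0]
    exact Nat.lt_floor_add_one _
  refine ⟨1 + j * M, by simp, ?_⟩
  have hM1 : (1 : ℝ) < M := by exact_mod_cast hM
  have hε' : (M : ℝ) < ε * (M : ℝ) ^ m := by rwa [div_lt_iff₀' hε] at hm
  have hdist : |((1 + j * M : ℕ) : ℝ) / (M : ℝ) ^ m - y| < ε := by
    rw [show ((1 + j * M : ℕ) : ℝ) / (M : ℝ) ^ m - y =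
      (1 + j * M - y * (M : ℝ) ^ m) / (M : ℝ) ^ m by push_cast; field_simp,
      abs_div, abs_of_pos hpow, div_lt_iff₀ hpow, abs_lt]
    constructor <;> linarith
  have := hball (y := ((1 + j * M : ℕ) : ℝ) / (M : ℝ) ^ m - n * M)
    (by rw [Real.dist_eq]; convert hdist using 2; rw [hy]; ring)
  rw [← this, ← hper (_ - _) n, sub_add_cancel]

/-- If for a full-dimensional lattice polytope `P` and `c ∈ ℚ^d` the
function `x ↦ #((xc + P) ∩ ℤ^d)` is not almost constant, then there is `c' ∈ ℚ^d` whose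
Ehrhart quasi-polynomial `L_{c'+P}` does not satisfy the GCD-property with respect to
the period `den(c')`. -/
theorem not_gcd_property_of_not_almost_constant
    (d : ℕ) (P : Set (Fin d → ℝ)) (hP : IsLatticePolytope P)
    (hdim : affineSpan ℝ P = ⊤) (c : Fin d → ℚ)
    (hnac : ¬ AlmostConstant fun x : ℝ => (latCount ((x • ratVec c) +ᵥ P) : ℝ)) :
    ∃ c' : Fin d → ℚ, ¬ GCDProperty (ehr P c') (denv c') := by
  set f : ℝ → ℝ := fun x => (latCount ((x • ratVec c) +ᵥ P) : ℝ) with hf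
  have hPb : Bornology.IsBounded P ∧ Convex ℝ P := by
    obtain ⟨V, -, rfl⟩ := hP
    exact ⟨isBounded_convexHull.2 (V.finite_toSet.image _).isBounded, convex_convexHull ℝ _⟩
  have hside : ∀ {x : ℝ} {l : Filter ℝ}, l ≤ 𝓝 x →
      (∀ T : Set ℝ, T.OrdConnected → ∃ p : Prop, ∀ᶠ y in l, (y ∈ T ↔ p)) →
      ∃ r, ∀ᶠ y in l, f y = r := by
    intro x l hlx hl
    obtain ⟨r, hr⟩ := latCount_smul_vadd_eventually_const hPb.1 hPb.2 (ratVec c) hlx hl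
    exact ⟨r, hr.mono fun y hy => congrArg (Nat.cast : ℕ → ℝ) hy⟩
  obtain ⟨x, y, hx, hy, hxy⟩ := exists_ne_of_not_almostConstant
    (fun x => hside nhdsWithin_le_nhds fun T hT => eventually_mem_iff_nhdsGT hT x)
    (fun x => hside nhdsWithin_le_nhds fun T hT => eventually_mem_iff_nhdsLT hT x) hnac
  set M := 2 * denv c
  have hM : 2 ≤ M := Nat.le_mul_of_pos_right 2 (denv_pos c)
  have hper : ∀ (x : ℝ) (n : ℕ), f (x + n * M) = f x := by
    intro x n
    obtain ⟨z, hz⟩ := exists_castVec_eq_smul_ratVec c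
      (((Dvd.intro_left 2 rfl : denv c ∣ M)).mul_left n)
    simp only [hf]
    rw [add_comm, add_smul, ← Nat.cast_mul, ← hz, ← vadd_vadd, latCount_castVec_vadd]
  obtain ⟨m, ⟨k, hk, hkx⟩, l, hl, hly⟩ := ((exists_coprime_div_pow_near hM hper hx).and
    (exists_coprime_div_pow_near hM hper hy)).exists
  refine ⟨((M ^ m : ℕ) : ℚ)⁻¹ • c, fun hgcd => hxy ?_⟩
  have hcop : ∀ n : ℕ, n.Coprime M → Nat.gcd (denv (((M ^ m : ℕ) : ℚ)⁻¹ • c)) n = 1 := by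
    intro n hn
    refine Nat.Coprime.coprime_dvd_left ((denv_inv_smul_dvd c _).trans
      (mul_dvd_mul_left _ (Dvd.intro_left 2 rfl : denv c ∣ M))) ?_
    exact Nat.Coprime.mul_left (hn.symm.pow_left m) hn.symm
  have hval : ∀ n : ℕ, f (n / (M : ℝ) ^ m) =
      latCount ((n : ℝ) • ratVec (((M ^ m : ℕ) : ℚ)⁻¹ • c) +ᵥ P) := by
    intro n
    simp only [hf]
    congr 3
    ext i
    simp [ratVec, div_eq_mul_inv, mul_assoc]
  rw [← hkx, ← hly, hval, hval,
    hP.latCount_eq_of_gcdProperty hgcd ((hcop k hk).trans (hcop l hl).symm)]
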